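/- arXiv:2407.15222 — 3 statements merged into one kernel-verified Lean document; each statement's English description precedes it below -/
import Mathlib

section
/- Let n ≥ 1 be an integer and α, β > 0 real numbers. There exists a constant C > 0, depending only on α, β and n, such that for every n×n real symmetric positive definite matrix Y, the series ∑_{T ∈ Λ_n^+} det(T)^α · exp(−β·tr(TY)) converges and its sum is at most C · det(Y)^{−(α + (n+1)/2)}. -/
open Real Matrix

/-- `Λ_n^+`: the set of `n × n` real symmetric positive definite matrices whose diagonal
entries are integers and whose off-diagonal entries are half-integers
(`2 * T i j ∈ ℤ`). -/
def HalfIntegralPosDef (n : ℕ) : Set (Matrix (Fin n) (Fin n) ℝ) :=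
  {T | T.PosDef ∧ (∀ i, ∃ m : ℤ, T i i = m) ∧ ∀ i j, ∃ m : ℤ, 2 * T i j = m}

open scoped ENNReal

/-- Cauchy-Schwarz inequality for a positive definite form and its dual form. -/
lemma Matrix.PosDef.sq_dotProduct_le {ι : Type*} [Fintype ι] [DecidableEq ι]
    {W : Matrix ι ι ℝ} (hW : W.PosDef) (u x : ι → ℝ) :
    (u ⬝ᵥ x) ^ 2 ≤ (u ⬝ᵥ W⁻¹ *ᵥ u) * (x ⬝ᵥ W *ᵥ x) := by
  have hsymm : ∀ a b : ι → ℝ, a ⬝ᵥ W *ᵥ b = b ⬝ᵥ W *ᵥ a := fun a b => by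
    have h : Wᵀ = W := by simpa using hW.isHermitian.eq
    rw [dotProduct_mulVec, ← mulVec_transpose, h, dotProduct_comm]
  set y := W⁻¹ *ᵥ u with hy
  have hWy : W *ᵥ y = u := by
    rw [hy, mulVec_mulVec, mul_nonsing_inv _ hW.det_pos.ne'.isUnit, one_mulVec]
  have h1 : ∀ t : ℝ, 0 ≤ (u ⬝ᵥ y) * (t * t) + (-2 * (u ⬝ᵥ x)) * t + (x ⬝ᵥ W *ᵥ x) := fun t => by
    have h := hW.posSemidef.dotProduct_mulVec_nonneg (x - t • y)
    simp only [star_trivial, mulVec_sub, mulVec_smul, hWy, dotProduct_sub, sub_dotProduct,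
      smul_dotProduct, dotProduct_smul, smul_eq_mul] at h
    rw [hsymm y x, hWy, dotProduct_comm x u, dotProduct_comm y u] at h
    linarith
  have h2 := discrim_le_zero h1
  rw [discrim] at h2
  linarith

open scoped MatrixOrder in
lemma Matrix.PosSemidef.dotProduct_mulVec_le_mul_trace {ι : Type*} [Fintype ι] [DecidableEq ι]
    {T Y : Matrix ι ι ℝ} (hT : T.PosSemidef) (hY : Y.PosDef) (u : ι → ℝ) :
    u ⬝ᵥ T *ᵥ u ≤ (u ⬝ᵥ Y⁻¹ *ᵥ u) * (T * Y).trace := by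
  obtain ⟨B, rfl⟩ : ∃ B : Matrix ι ι ℝ, T = Bᵀ * B := by
    simpa [star_eq_conjTranspose] using CStarAlgebra.nonneg_iff_eq_star_mul_self.mp hT.nonneg
  have h1 : u ⬝ᵥ (Bᵀ * B) *ᵥ u = ∑ k, (u ⬝ᵥ B k) ^ 2 := by
    rw [← mulVec_mulVec, dotProduct_mulVec, vecMul_transpose]
    exact Finset.sum_congr rfl fun k _ => by
      rw [dotProduct_comm u, sq]; rfl
  have h2 : ((Bᵀ * B) * Y).trace = ∑ k, (B k ⬝ᵥ Y *ᵥ B k) := by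
    rw [Matrix.mul_assoc, trace_mul_comm, trace]
    refine Finset.sum_congr rfl fun k _ => ?_
    rw [dotProduct_mulVec]; rfl
  rw [h1, h2, Finset.mul_sum]
  exact Finset.sum_le_sum fun k _ => hY.sq_dotProduct_le _ _

/-- The Schur complement of the top left entry. -/
noncomputable def schurSucc {n : ℕ} (A : Matrix (Fin (n + 1)) (Fin (n + 1)) ℝ) : Matrix (Fin n) (Fin n) ℝ :=
  Matrix.of fun i j => A i.succ j.succ - A 0 i.succ * A 0 j.succ / A 0 0

lemma det_eq_mul_det_schurSucc {n : ℕ} {A : Matrix (Fin (n + 1)) (Fin (n + 1)) ℝ}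
    (hA : A.PosDef) : A.det = A 0 0 * (schurSucc A).det := by
  have ha : A 0 0 ≠ 0 := hA.diag_pos.ne'
  have hs : ∀ i j, A i j = A j i := fun i j => by simpa using (hA.isHermitian.apply j i)
  have h1 : A.det = (Matrix.of fun i j => A i j - (if i = 0 then 0 else A i 0 / A 0 0) * A 0 j :
      Matrix (Fin (n + 1)) (Fin (n + 1)) ℝ).det :=
    det_eq_of_forall_row_eq_smul_add_const (fun i => if i = 0 then 0 else A i 0 / A 0 0) 0 (by simp)
      (fun i j => by simp)
  rw [h1, det_succ_column_zero, Fin.sum_univ_succ, Finset.sum_eq_zero]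
  · simp only [of_apply, if_true, Fin.val_zero, pow_zero, one_mul, zero_mul, sub_zero, add_zero]
    congr 2
    ext i j
    simp [schurSucc, Fin.succ_ne_zero, hs i.succ 0]
    ring
  · intro i _
    simp [Fin.succ_ne_zero, ha]

/-- The value of a form at a vector with first coordinate `r`, after completing the square. -/
lemma dotProduct_mulVec_cons {n : ℕ} {A : Matrix (Fin (n + 1)) (Fin (n + 1)) ℝ}
    (hA : A.PosDef) (r : ℝ) (x : Fin n → ℝ) :
    (Fin.cons r x : Fin (n + 1) → ℝ) ⬝ᵥ A *ᵥ (Fin.cons r x : Fin (n + 1) → ℝ) =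
      x ⬝ᵥ schurSucc A *ᵥ x + (A 0 0 * r + ∑ k, A 0 k.succ * x k) ^ 2 / A 0 0 := by
  have ha : A 0 0 ≠ 0 := hA.diag_pos.ne'
  have hs : ∀ i j, A i j = A j i := fun i j => by simpa using (hA.isHermitian.apply j i)
  set b := ∑ k, A 0 k.succ * x k with hb
  have h1 : x ⬝ᵥ schurSucc A *ᵥ x = ∑ i, x i * (∑ j, A i.succ j.succ * x j) - b * b / A 0 0 := by
    rw [hb, Finset.sum_mul, Finset.sum_div, ← Finset.sum_sub_distrib]
    refine Finset.sum_congr rfl fun i _ => ?_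
    simp only [mulVec, dotProduct, schurSucc, of_apply]
    rw [show A 0 i.succ * x i * (∑ k, A 0 k.succ * x k) / A 0 0 =
      x i * (A 0 i.succ / A 0 0 * ∑ k, A 0 k.succ * x k) by ring, ← mul_sub]
    congr 1
    rw [Finset.mul_sum, ← Finset.sum_sub_distrib]
    exact Finset.sum_congr rfl fun j _ => by ring
  have h2 : ∑ i, x i * (A i.succ 0 * r) = r * b := by
    rw [hb, Finset.mul_sum]
    exact Finset.sum_congr rfl fun i _ => by rw [hs i.succ 0]; ring
  rw [h1]
  simp only [mulVec, dotProduct, Fin.sum_univ_succ, Fin.cons_zero, Fin.cons_succ, mul_add,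
    Finset.sum_add_distrib, h2, ← hb]
  field_simp
  ring

lemma posDef_schurSucc {n : ℕ} {A : Matrix (Fin (n + 1)) (Fin (n + 1)) ℝ}
    (hA : A.PosDef) : (schurSucc A).PosDef := by
  have ha : A 0 0 ≠ 0 := hA.diag_pos.ne'
  have hs : ∀ i j, A i j = A j i := fun i j => by simpa using (hA.isHermitian.apply j i)
  refine PosDef.of_dotProduct_mulVec_pos ?_ fun x hx => ?_
  · ext i j
    simp only [schurSucc, conjTranspose_apply, of_apply, star_trivial, hs j.succ i.succ]
    ring
  · have hne : (Fin.cons (-(∑ k, A 0 k.succ * x k) / A 0 0) x : Fin (n + 1) → ℝ) ≠ 0 := fun h =>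
      hx (funext fun i => by simpa using congrFun h i.succ)
    have := hA.dotProduct_mulVec_pos hne
    rw [star_trivial, dotProduct_mulVec_cons hA, mul_div_cancel₀ _ ha] at this
    simpa using this

/-- Hadamard's inequality for positive definite matrices. -/
lemma det_le_prod_diag {n : ℕ} {A : Matrix (Fin n) (Fin n) ℝ} (hA : A.PosDef) :
    A.det ≤ ∏ i, A i i := by
  induction n with
  | zero => simp
  | succ n ih =>
    have ha : 0 < A 0 0 := hA.diag_pos
    rw [det_eq_mul_det_schurSucc hA, Fin.prod_univ_succ]
    gcongr
    refine (ih (posDef_schurSucc hA)).trans ?_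
    refine Finset.prod_le_prod (fun i _ => (posDef_schurSucc hA).diag_pos.le) fun i _ => ?_
    have : 0 ≤ A 0 i.succ * A 0 i.succ / A 0 0 := div_nonneg (mul_self_nonneg _) ha.le
    simp only [schurSucc, of_apply]
    linarith

lemma dotProduct_conj_mulVec {ι : Type*} [Fintype ι] (M Z : Matrix ι ι ℝ) (x : ι → ℝ) :
    x ⬝ᵥ (M * Z * Mᵀ) *ᵥ x = (x ᵥ* M) ⬝ᵥ Z *ᵥ (x ᵥ* M) := by
  rw [← mulVec_mulVec, ← mulVec_mulVec, dotProduct_mulVec, mulVec_transpose]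

lemma conj_apply_self {ι : Type*} [Fintype ι] [DecidableEq ι] (M Z : Matrix ι ι ℝ) (i : ι) :
    (M * Z * Mᵀ) i i = M i ⬝ᵥ Z *ᵥ M i := by
  have h := dotProduct_conj_mulVec M Z (Pi.single i 1)
  rw [single_one_dotProduct, mulVec_single_one, single_one_vecMul] at h
  exact h

lemma posDef_conj {ι : Type*} [Fintype ι] [DecidableEq ι] {M Z : Matrix ι ι ℝ} (hZ : Z.PosDef)
    (hM : IsUnit M.det) : (M * Z * Mᵀ).PosDef := by
  have h := hZ.mul_mul_conjTranspose_same (B := M)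
    (vecMul_injective_of_isUnit ((isUnit_iff_isUnit_det M).2 hM))
  simpa using h

/-- The values of a positive definite form at nonzero integral vectors are bounded below. -/
lemma exists_pos_le_of_intVec {ι : Type*} [Fintype ι] [DecidableEq ι] {Z : Matrix ι ι ℝ}
    (hZ : Z.PosDef) : ∃ μ : ℝ, 0 < μ ∧ ∀ x : ι → ℤ, x ≠ 0 →
      μ ≤ (fun i => (x i : ℝ)) ⬝ᵥ Z *ᵥ (fun i => (x i : ℝ)) := by
  have hd : ∀ i, 0 < Z⁻¹ i i := fun i => hZ.inv.diag_pos
  have hM : 0 < 1 + ∑ i, Z⁻¹ i i := by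
    have := Finset.sum_nonneg fun i (_ : i ∈ Finset.univ) => (hd i).le
    linarith
  refine ⟨(1 + ∑ i, Z⁻¹ i i)⁻¹, inv_pos.2 hM, fun x hx => ?_⟩
  obtain ⟨i, hi⟩ : ∃ i, x i ≠ 0 := Function.ne_iff.1 hx
  have h1 := hZ.sq_dotProduct_le (Pi.single i 1) (fun i => (x i : ℝ))
  have h2 : (1 : ℝ) ≤ (x i : ℝ) ^ 2 := by
    exact_mod_cast Int.one_le_abs (pow_ne_zero 2 hi) |>.trans_eq (abs_of_nonneg (sq_nonneg _))
  have h0 := hZ.posSemidef.dotProduct_mulVec_nonneg (fun i => (x i : ℝ))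
  have h3 := Finset.single_le_sum (fun i _ => (hd i).le) (Finset.mem_univ i)
  rw [single_one_dotProduct, mulVec_single_one, single_one_dotProduct, col_apply] at h1
  rw [star_trivial] at h0
  rw [inv_le_iff_one_le_mul₀ hM]
  nlinarith

lemma isUnit_det_map {ι : Type*} [Fintype ι] [DecidableEq ι] {U : Matrix ι ι ℤ}
    (hU : IsUnit U.det) : IsUnit (U.map (Int.castRingHom ℝ)).det := by
  rw [show (U.map (Int.castRingHom ℝ)).det = Int.castRingHom ℝ U.det from
    (RingHom.map_det (Int.castRingHom ℝ) U).symm]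
  exact hU.map _

lemma det_map_sq {ι : Type*} [Fintype ι] [DecidableEq ι] {U : Matrix ι ι ℤ}
    (hU : IsUnit U.det) : (U.map (Int.castRingHom ℝ)).det ^ 2 = 1 := by
  rw [show (U.map (Int.castRingHom ℝ)).det = (U.det : ℝ) from
    (RingHom.map_det (Int.castRingHom ℝ) U).symm]
  exact_mod_cast Int.isUnit_sq hU

lemma det_conj_map {ι : Type*} [Fintype ι] [DecidableEq ι] {U : Matrix ι ι ℤ}
    (hU : IsUnit U.det) (Z : Matrix ι ι ℝ) :
    (U.map (Int.castRingHom ℝ) * Z * (U.map (Int.castRingHom ℝ))ᵀ).det = Z.det := by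
  rw [det_mul, det_mul, det_transpose]
  linear_combination Z.det * det_map_sq hU

/-- A unimodular matrix whose first row is, up to a factor `2`, shortest among first rows of
unimodular matrices. -/
lemma exists_first_row_near_min {n : ℕ} {Z : Matrix (Fin (n + 1)) (Fin (n + 1)) ℝ}
    (hZ : Z.PosDef) : ∃ U : Matrix (Fin (n + 1)) (Fin (n + 1)) ℤ, IsUnit U.det ∧
      ∀ W : Matrix (Fin (n + 1)) (Fin (n + 1)) ℤ, IsUnit W.det →
        U.map (Int.castRingHom ℝ) 0 ⬝ᵥ Z *ᵥ U.map (Int.castRingHom ℝ) 0 ≤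
          2 * (W.map (Int.castRingHom ℝ) 0 ⬝ᵥ Z *ᵥ W.map (Int.castRingHom ℝ) 0) := by
  obtain ⟨μ, hμ, h⟩ := exists_pos_le_of_intVec hZ
  set f : {W : Matrix (Fin (n + 1)) (Fin (n + 1)) ℤ // IsUnit W.det} → ℝ := fun W =>
    W.1.map (Int.castRingHom ℝ) 0 ⬝ᵥ Z *ᵥ W.1.map (Int.castRingHom ℝ) 0 with hf
  have hlow : ∀ W, μ ≤ f W := fun W => h (W.1 0) fun h0 => by
    have := W.2
    rw [det_eq_zero_of_row_eq_zero 0 (congrFun h0)] at this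
    exact not_isUnit_zero this
  have : Nonempty {W : Matrix (Fin (n + 1)) (Fin (n + 1)) ℤ // IsUnit W.det} := ⟨⟨1, by simp⟩⟩
  have hbdd : BddBelow (Set.range f) := ⟨μ, by rintro _ ⟨W, rfl⟩; exact hlow W⟩
  have hinf : 0 < ⨅ W, f W := hμ.trans_le (le_ciInf hlow)
  obtain ⟨U, hU⟩ := exists_lt_of_ciInf_lt (show ⨅ W, f W < 2 * ⨅ W, f W by linarith)
  exact ⟨U.1, U.2, fun W hW => by
    have := ciInf_le hbdd ⟨W, hW⟩
    have h2 : f U ≤ 2 * f ⟨W, hW⟩ := by linarith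
    exact h2⟩

/-- Extend a unimodular matrix by a first row `e₀` and a first column `u`. -/
def bordered {n : ℕ} (u : Fin n → ℤ) (V : Matrix (Fin n) (Fin n) ℤ) :
    Matrix (Fin (n + 1)) (Fin (n + 1)) ℤ :=
  Matrix.of (Fin.cons (Fin.cons 1 0) fun i => Fin.cons (u i) (V i))

lemma det_bordered {n : ℕ} (u : Fin n → ℤ) (V : Matrix (Fin n) (Fin n) ℤ) :
    (bordered u V).det = V.det := by
  rw [det_succ_row_zero, Fin.sum_univ_succ, Finset.sum_eq_zero]
  · have : (bordered u V).submatrix Fin.succ (Fin.succAbove 0) = V := by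
      ext i j
      simp [bordered]
    simp only [this]
    simp [bordered]
  · intro i _
    simp [bordered]

/-- Hermite reduction for forms with nearly minimal first coefficient. -/
lemma exists_bordered_prod_le {n : ℕ} {C : ℝ} {Z : Matrix (Fin (n + 1)) (Fin (n + 1)) ℝ}
    (hZ : Z.PosDef)
    (hmin : ∀ W : Matrix (Fin (n + 1)) (Fin (n + 1)) ℤ, IsUnit W.det →
      Z 0 0 ≤ 2 * (W.map (Int.castRingHom ℝ) 0 ⬝ᵥ Z *ᵥ W.map (Int.castRingHom ℝ) 0))
    {V : Matrix (Fin n) (Fin n) ℤ} (hV : IsUnit V.det)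
    (hprod : ∏ j, (V.map (Int.castRingHom ℝ) j ⬝ᵥ schurSucc Z *ᵥ V.map (Int.castRingHom ℝ) j) ≤
      C * (schurSucc Z).det) :
    ∃ U : Matrix (Fin (n + 1)) (Fin (n + 1)) ℤ, IsUnit U.det ∧
      ∏ j, (U.map (Int.castRingHom ℝ) j ⬝ᵥ Z *ᵥ U.map (Int.castRingHom ℝ) j) ≤
        2 ^ n * C * Z.det := by
  have ha : 0 < Z 0 0 := hZ.diag_pos
  set b : Fin n → ℝ := fun j => ∑ k, Z 0 k.succ * (V j k : ℝ) with hb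
  set U := bordered (fun j => -round (b j / Z 0 0)) V with hU
  have hUdet : IsUnit U.det := by rwa [hU, det_bordered]
  have hrow : ∀ j : Fin n, U.map (Int.castRingHom ℝ) j.succ =
      Fin.cons (-(round (b j / Z 0 0) : ℝ)) (V.map (Int.castRingHom ℝ) j) := fun j => by
    ext k
    refine Fin.cases ?_ (fun k => ?_) k <;> simp [hU, bordered]
  have hrow0 : U.map (Int.castRingHom ℝ) 0 = Fin.cons 1 0 := by
    ext k
    refine Fin.cases ?_ (fun k => ?_) k <;> simp [hU, bordered]
  have hq0 : U.map (Int.castRingHom ℝ) 0 ⬝ᵥ Z *ᵥ U.map (Int.castRingHom ℝ) 0 = Z 0 0 := by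
    rw [hrow0, dotProduct_mulVec_cons hZ]
    simp [sq, ha.ne']
  have hq : ∀ j : Fin n,
      U.map (Int.castRingHom ℝ) j.succ ⬝ᵥ Z *ᵥ U.map (Int.castRingHom ℝ) j.succ ≤
        2 * (V.map (Int.castRingHom ℝ) j ⬝ᵥ schurSucc Z *ᵥ V.map (Int.castRingHom ℝ) j) := by
    intro j
    have hm := hmin (U.submatrix (Equiv.swap 0 j.succ) id) (by
      rw [det_permute]
      exact (Units.isUnit _).map (Int.castRingHom ℤ) |>.mul hUdet)
    have hr : (U.submatrix (Equiv.swap 0 j.succ) id).map (Int.castRingHom ℝ) 0 =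
        U.map (Int.castRingHom ℝ) j.succ := by
      ext k
      simp
    rw [hr] at hm
    have hcons := dotProduct_mulVec_cons hZ (-(round (b j / Z 0 0) : ℝ))
      (V.map (Int.castRingHom ℝ) j)
    rw [← hrow j] at hcons
    have hsum : ∑ k, Z 0 k.succ * V.map (Int.castRingHom ℝ) j k = b j := rfl
    rw [hsum] at hcons
    have hround : (Z 0 0 * -(round (b j / Z 0 0) : ℝ) + b j) ^ 2 / Z 0 0 ≤ Z 0 0 / 4 := by
      have h1 : Z 0 0 * -(round (b j / Z 0 0) : ℝ) + b j =
          Z 0 0 * (b j / Z 0 0 - round (b j / Z 0 0)) := by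
        field_simp
        ring
      have h2 : (b j / Z 0 0 - round (b j / Z 0 0)) ^ 2 ≤ (1 / 2) ^ 2 :=
        sq_le_sq' (by linarith [(abs_le.1 (abs_sub_round (b j / Z 0 0))).1])
          (abs_le.1 (abs_sub_round (b j / Z 0 0))).2
      rw [h1, mul_pow, div_le_iff₀ ha]
      nlinarith [mul_pos ha ha]
    linarith
  refine ⟨U, hUdet, ?_⟩
  rw [Fin.prod_univ_succ, hq0, det_eq_mul_det_schurSucc hZ]
  have hle : ∏ j : Fin n, (U.map (Int.castRingHom ℝ) j.succ ⬝ᵥ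
      Z *ᵥ U.map (Int.castRingHom ℝ) j.succ) ≤ 2 ^ n * (C * (schurSucc Z).det) := by
    refine (Finset.prod_le_prod (fun j _ => ?_) fun j _ => hq j).trans ?_
    · simpa using hZ.posSemidef.dotProduct_mulVec_nonneg (U.map (Int.castRingHom ℝ) j.succ)
    · rw [Finset.prod_mul_distrib, Finset.prod_const, Finset.card_univ, Fintype.card_fin]
      gcongr
  calc _ ≤ Z 0 0 * (2 ^ n * (C * (schurSucc Z).det)) := by gcongr
    _ = _ := by ring

/-- Every positive definite form has an integral basis such that the product of its values on
the basis is bounded by a constant times its determinant. -/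
lemma exists_unimodular_prod_le (n : ℕ) : ∃ C : ℝ, 0 < C ∧
    ∀ Z : Matrix (Fin n) (Fin n) ℝ, Z.PosDef → ∃ U : Matrix (Fin n) (Fin n) ℤ, IsUnit U.det ∧
      ∏ j, (U.map (Int.castRingHom ℝ) j ⬝ᵥ Z *ᵥ U.map (Int.castRingHom ℝ) j) ≤ C * Z.det := by
  induction n with
  | zero => exact ⟨1, one_pos, fun Z _ => ⟨1, by simp, by simp⟩⟩
  | succ n ih =>
    obtain ⟨C, hC, ih⟩ := ih
    refine ⟨2 ^ n * C, by positivity, fun Z hZ => ?_⟩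
    obtain ⟨U, hU, hmin⟩ := exists_first_row_near_min hZ
    set M := U.map (Int.castRingHom ℝ) with hM
    have hZ' := posDef_conj hZ (isUnit_det_map hU)
    rw [← hM] at hZ'
    have key : ∀ (W : Matrix (Fin (n + 1)) (Fin (n + 1)) ℤ) (j : Fin (n + 1)),
        W.map (Int.castRingHom ℝ) j ⬝ᵥ (M * Z * Mᵀ) *ᵥ W.map (Int.castRingHom ℝ) j =
          (W * U).map (Int.castRingHom ℝ) j ⬝ᵥ Z *ᵥ (W * U).map (Int.castRingHom ℝ) j := by
      intro W j
      rw [dotProduct_conj_mulVec, Matrix.map_mul]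
      rfl
    obtain ⟨V, hV, hprod⟩ := ih _ (posDef_schurSucc hZ')
    obtain ⟨W, hW, hWprod⟩ := exists_bordered_prod_le hZ' (fun W hW => by
      rw [key, conj_apply_self]
      exact hmin _ (by rw [det_mul]; exact hW.mul hU)) hV hprod
    refine ⟨W * U, by rw [det_mul]; exact hW.mul hU, ?_⟩
    rw [det_conj_map hU] at hWprod
    simpa only [key] using hWprod

lemma ENNReal.tsum_pi_prod (n : ℕ) (f : Fin n → ℕ → ℝ≥0∞) :
    ∑' t : Fin n → ℕ, ∏ i, f i (t i) = ∏ i, ∑' k, f i k := by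
  induction n with
  | zero => simp
  | succ n ih =>
    rw [← (Fin.consEquiv fun _ => ℕ).tsum_eq, ENNReal.tsum_prod', Fin.prod_univ_succ, ← ih,
      ← ENNReal.tsum_mul_right]
    refine tsum_congr fun a => ?_
    rw [← ENNReal.tsum_mul_left]
    refine tsum_congr fun t => ?_
    simp [Fin.consEquiv, Fin.prod_univ_succ]

/-- The diagonal of a half-integral positive definite matrix. -/
noncomputable def diagNat {n : ℕ} (T : HalfIntegralPosDef n) (i : Fin n) : ℕ := ⌊T.val i i⌋₊

lemma diagNat_cast {n : ℕ} (T : HalfIntegralPosDef n) (i : Fin n) :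
    (diagNat T i : ℝ) = T.val i i := by
  obtain ⟨m, hm⟩ := T.2.2.1 i
  have h0 : 0 < T.val i i := T.2.1.diag_pos
  rw [hm] at h0
  lift m to ℕ using by exact_mod_cast h0.le
  rw [diagNat, hm]
  simp

lemma one_le_diagNat {n : ℕ} (T : HalfIntegralPosDef n) (i : Fin n) : 1 ≤ diagNat T i := by
  have h0 : 0 < T.val i i := T.2.1.diag_pos
  rw [← diagNat_cast] at h0
  exact_mod_cast h0

lemma floor_two_mul_cast {n : ℕ} (T : HalfIntegralPosDef n) (i j : Fin n) :
    (⌊2 * T.val i j⌋ : ℝ) = 2 * T.val i j := by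
  obtain ⟨m, hm⟩ := T.2.2.2 i j
  rw [hm, Int.floor_intCast]

lemma Matrix.PosDef.sq_apply_le {ι : Type*} [Fintype ι] [DecidableEq ι] {A : Matrix ι ι ℝ}
    (hA : A.PosDef) (i j : ι) : A i j ^ 2 ≤ A i i * A j j := by
  have hs : A j i = A i j := by simpa using (hA.isHermitian.apply i j)
  have h1 : ∀ t : ℝ, 0 ≤ A i i * (t * t) + (2 * A i j) * t + A j j := fun t => by
    have h := hA.posSemidef.dotProduct_mulVec_nonneg (t • Pi.single i 1 + Pi.single j 1)
    simp only [star_trivial, mulVec_add, mulVec_smul, mulVec_single_one, add_dotProduct,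
      smul_dotProduct, single_one_dotProduct, Pi.add_apply, Pi.smul_apply, col_apply,
      smul_eq_mul, hs] at h
    linarith
  have h2 := discrim_le_zero h1
  rw [discrim] at h2
  linarith

/-- The integer vectors that may occur as strict upper triangular part of `2T`, when `T` is
positive definite with diagonal `t`. -/
noncomputable def upperBox {n : ℕ} (t : Fin n → ℕ) : Finset (Fin n → Fin n → ℤ) :=
  Fintype.piFinset fun i => Fintype.piFinset fun j =>
    if i < j then Finset.Icc (-⌊2 * √(t i * t j)⌋) ⌊2 * √(t i * t j)⌋ else {0}

/-- The strict upper triangular part of `2T`. -/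
noncomputable def upperPart {n : ℕ} (T : HalfIntegralPosDef n) (i j : Fin n) : ℤ :=
  if i < j then ⌊2 * T.val i j⌋ else 0

lemma upperPart_mem {n : ℕ} (T : HalfIntegralPosDef n) :
    upperPart T ∈ upperBox (diagNat T) := by
  simp only [upperBox, Fintype.mem_piFinset]
  intro i j
  by_cases hij : i < j
  · simp only [upperPart, hij, if_true, Finset.mem_Icc]
    have h : |2 * T.val i j| ≤ 2 * √(diagNat T i * diagNat T j) := by
      rw [abs_mul, abs_two, diagNat_cast, diagNat_cast]
      gcongr
      exact Real.abs_le_sqrt (T.2.1.sq_apply_le i j)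
    rw [← floor_two_mul_cast] at h
    rw [← abs_le]
    exact Int.le_floor.2 (by exact_mod_cast h)
  · simp [upperPart, hij]

lemma eq_of_diagNat_eq_of_upperPart_eq {n : ℕ} {T T' : HalfIntegralPosDef n}
    (hd : diagNat T = diagNat T') (hu : upperPart T = upperPart T') : T = T' := by
  have hlt : ∀ i j, i < j → T.val i j = T'.val i j := fun i j hij => by
    have h := congrFun (congrFun hu i) j
    simp only [upperPart, hij, if_true] at h
    have h2 := congrArg (Int.cast : ℤ → ℝ) h
    rw [floor_two_mul_cast, floor_two_mul_cast] at h2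
    linarith
  have hs : ∀ (S : HalfIntegralPosDef n) i j, S.val i j = S.val j i := fun S i j => by
    simpa using (S.2.1.isHermitian.apply j i)
  ext i j
  rcases lt_trichotomy i j with h | rfl | h
  · exact hlt i j h
  · rw [← diagNat_cast, ← diagNat_cast, hd]
  · rw [hs T, hs T', hlt j i h]

lemma prod_prod_Ioi_mul {n : ℕ} {M : Type*} [CommMonoid M] (w : Fin n → M) :
    ∏ i, ∏ j ∈ Finset.Ioi i, (w i * w j) = ∏ i, w i ^ (n - 1) := by
  have h : ∏ i, ∏ j ∈ Finset.Ioi i, w j = ∏ j, ∏ i ∈ Finset.Iio j, w j :=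
    Finset.prod_comm' (by simp)
  simp only [Finset.prod_mul_distrib]
  rw [h, ← Finset.prod_mul_distrib]
  refine Finset.prod_congr rfl fun i _ => ?_
  rw [Finset.prod_const, Finset.prod_const, ← pow_add, Fin.card_Ioi, Fin.card_Iio]
  congr 1
  omega

lemma card_upperBox_le {n : ℕ} {t : Fin n → ℕ} (ht : ∀ i, 1 ≤ t i) :
    ((upperBox t).card : ℝ) ≤ ∏ i, (5 ^ n * √(t i) ^ (n - 1)) := by
  have hcard : ((upperBox t).card : ℝ) = ∏ i, ∏ j ∈ Finset.Ioi i,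
      ((Finset.Icc (-⌊2 * √(t i * t j)⌋) ⌊2 * √(t i * t j)⌋).card : ℝ) := by
    rw [upperBox, Fintype.card_piFinset]
    push_cast
    refine Finset.prod_congr rfl fun i _ => ?_
    rw [Fintype.card_piFinset, ← Finset.filter_lt_eq_Ioi, Finset.prod_filter]
    push_cast
    refine Finset.prod_congr rfl fun j _ => ?_
    split_ifs <;> simp
  have hle : ∀ i j, ((Finset.Icc (-⌊2 * √(t i * t j)⌋) ⌊2 * √(t i * t j)⌋).card : ℝ) ≤
      5 * (√(t i) * √(t j)) := fun i j => by
    rw [← Real.sqrt_mul (by positivity)]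
    have h1 : (1 : ℝ) ≤ √(t i * t j) := by
      rw [Real.one_le_sqrt]
      exact_mod_cast Nat.mul_pos (ht i) (ht j)
    have h2 := Int.floor_le (2 * √(t i * t j : ℝ))
    have h3 : 0 ≤ ⌊2 * √(t i * t j : ℝ)⌋ := Int.floor_nonneg.2 (by positivity)
    have h4 : ((Finset.Icc (-⌊2 * √(t i * t j : ℝ)⌋) ⌊2 * √(t i * t j : ℝ)⌋).card : ℤ) =
        2 * ⌊2 * √(t i * t j : ℝ)⌋ + 1 := by
      rw [Int.card_Icc, Int.toNat_of_nonneg (by omega)]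
      ring
    have h5 : ((Finset.Icc (-⌊2 * √(t i * t j : ℝ)⌋) ⌊2 * √(t i * t j : ℝ)⌋).card : ℝ) =
        2 * ⌊2 * √(t i * t j : ℝ)⌋ + 1 := by exact_mod_cast h4
    rw [h5]
    linarith
  rw [hcard]
  calc _ ≤ ∏ i, ∏ j ∈ Finset.Ioi i, (5 * (√(t i : ℝ) * √(t j))) :=
        Finset.prod_le_prod (fun i _ => Finset.prod_nonneg fun j _ => by positivity) fun i _ =>
          Finset.prod_le_prod (fun j _ => by positivity) fun j _ => hle i j
    _ = (∏ i : Fin n, (5 : ℝ) ^ (n - 1 - i : ℕ)) * ∏ i, √(t i : ℝ) ^ (n - 1) := by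
        rw [← prod_prod_Ioi_mul, ← Finset.prod_mul_distrib]
        refine Finset.prod_congr rfl fun i _ => ?_
        rw [Finset.prod_mul_distrib, Finset.prod_const, Fin.card_Ioi]
    _ ≤ (∏ i : Fin n, (5 : ℝ) ^ n) * ∏ i, √(t i : ℝ) ^ (n - 1) := by
        gcongr with i
        · norm_num
        · omega
    _ = _ := by rw [← Finset.prod_mul_distrib]

lemma tsum_prod_diagNat_le {n : ℕ} (F : Fin n → ℕ → ℝ≥0∞) :
    ∑' T : HalfIntegralPosDef n, ∏ i, F i (diagNat T i) ≤
      ∏ i, ∑' k : ℕ, ENNReal.ofReal (5 ^ n * √k ^ (n - 1)) * F i k := by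
  rw [← ENNReal.tsum_pi_prod, ← (Equiv.sigmaFiberEquiv (diagNat (n := n))).tsum_eq,
    ENNReal.tsum_sigma']
  refine ENNReal.tsum_le_tsum fun t => ?_
  have hc : ∀ T : {T : HalfIntegralPosDef n // diagNat T = t},
      ∏ i, F i (diagNat (Equiv.sigmaFiberEquiv (diagNat (n := n)) ⟨t, T⟩) i) =
        ∏ i, F i (t i) := fun T =>
    Finset.prod_congr rfl fun i _ => congrArg (F i) (congrFun T.2 i)
  rw [tsum_congr hc, ENNReal.tsum_const, Finset.prod_mul_distrib]
  gcongr
  by_cases ht : ∀ i, 1 ≤ t i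
  · have hinj : Function.Injective fun T : {T : HalfIntegralPosDef n // diagNat T = t} =>
        (⟨upperPart T.1, by obtain ⟨T, rfl⟩ := T; exact upperPart_mem T⟩ : upperBox t) := fun T T' h =>
      Subtype.ext (eq_of_diagNat_eq_of_upperPart_eq (T.2.trans T'.2.symm) (congrArg Subtype.val h))
    have h1 := ENat.card_le_card_of_injective hinj
    rw [ENat.card_eq_coe_fintype_card (α := upperBox t), Fintype.card_coe] at h1
    rw [← ENNReal.ofReal_prod_of_nonneg fun i _ => by positivity]
    calc _ ≤ (((upperBox t).card : ℕ∞) : ℝ≥0∞) := by exact_mod_cast h1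
      _ = ENNReal.ofReal (upperBox t).card := by simp
      _ ≤ _ := ENNReal.ofReal_le_ofReal (card_upperBox_le ht)
  · have : IsEmpty {T : HalfIntegralPosDef n // diagNat T = t} :=
      ⟨fun T => ht fun i => T.2 ▸ one_le_diagNat T.1 i⟩
    rw [ENat.card_eq_zero_iff_empty _ |>.2 this]
    simp

/-- `∑_{k ≥ 1} k^p e^{-yk} ≪ y^{-(p+1)}`, uniformly in `y > 0`. -/
lemma tsum_rpow_mul_exp_le {p : ℝ} (hp : 0 < p) {y : ℝ} (hy : 0 < y) :
    ∑' k : ℕ, ENNReal.ofReal ((k : ℝ) ^ p * Real.exp (-(y * k))) ≤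
      ENNReal.ofReal (2 * (2 * p) ^ p * y ^ (-(p + 1))) := by
  have hbound : ∀ k : ℕ, (k : ℝ) ^ p * Real.exp (-(y * k)) ≤
      if k = 0 then 0 else (2 * p / y) ^ p * Real.exp (-(y / 2)) ^ k := fun k => by
    split_ifs with hk
    · simp [hk, Real.zero_rpow hp.ne']
    · have h1 : (k : ℝ) ≤ 2 * p / y * Real.exp (y * k / (2 * p)) := by
        have h := (Real.add_one_le_exp (y * k / (2 * p)))
        have h2 : (k : ℝ) = 2 * p / y * (y * k / (2 * p)) := by field_simp
        nth_rewrite 1 [h2]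
        gcongr
        linarith
      have h2 : (k : ℝ) ^ p ≤ (2 * p / y) ^ p * Real.exp (y * k / 2) := by
        refine (Real.rpow_le_rpow (Nat.cast_nonneg k) h1 hp.le).trans_eq ?_
        rw [Real.mul_rpow (by positivity) (Real.exp_pos _).le, ← Real.exp_mul]
        congr 2
        field_simp
      calc _ ≤ (2 * p / y) ^ p * Real.exp (y * k / 2) * Real.exp (-(y * k)) := by gcongr
        _ = _ := by
          rw [mul_assoc, ← Real.exp_add, ← Real.exp_nat_mul]
          congr 2
          ring
  set r := Real.exp (-(y / 2)) with hr
  have hr0 : 0 < r := Real.exp_pos _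
  have hr1 : r < 1 := by rw [hr, Real.exp_lt_one_iff]; linarith
  have hgeom : ∑' k : ℕ, ENNReal.ofReal (r ^ (k + 1)) ≤ ENNReal.ofReal (2 / y) := by
    have hs : Summable fun k : ℕ => r ^ (k + 1) := by
      simp only [pow_succ]
      exact (summable_geometric_of_lt_one hr0.le hr1).mul_right r
    rw [← ENNReal.ofReal_tsum_of_nonneg (fun k => by positivity) hs]
    refine ENNReal.ofReal_le_ofReal ?_
    simp only [pow_succ]
    rw [tsum_mul_right, tsum_geometric_of_lt_one hr0.le hr1, ← div_eq_inv_mul,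
      div_le_div_iff₀ (by linarith) hy]
    have h1 := Real.add_one_le_exp (y / 2)
    have h2 : r * Real.exp (y / 2) = 1 := by rw [hr, ← Real.exp_add]; simp
    nlinarith
  calc _ ≤ ∑' k : ℕ, ENNReal.ofReal (if k = 0 then 0 else (2 * p / y) ^ p * r ^ k) :=
        ENNReal.tsum_le_tsum fun k => ENNReal.ofReal_le_ofReal (hbound k)
    _ = ∑' k : ℕ, ENNReal.ofReal ((2 * p / y) ^ p) * ENNReal.ofReal (r ^ (k + 1)) := by
        rw [tsum_eq_zero_add' ENNReal.summable]
        simp only [if_true, ENNReal.ofReal_zero, zero_add, Nat.succ_ne_zero, if_false]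
        exact tsum_congr fun k => ENNReal.ofReal_mul (by positivity)
    _ ≤ ENNReal.ofReal ((2 * p / y) ^ p) * ENNReal.ofReal (2 / y) := by
        rw [ENNReal.tsum_mul_left]
        gcongr
    _ = _ := by
        rw [← ENNReal.ofReal_mul (by positivity)]
        congr 1
        rw [Real.div_rpow (by positivity) hy.le, Real.rpow_neg hy.le, Real.rpow_add_one hy.ne']
        field_simp

lemma map_mem_halfIntegralPosDef {n : ℕ} {U : Matrix (Fin n) (Fin n) ℤ} (hU : IsUnit U.det)
    {T : Matrix (Fin n) (Fin n) ℝ} (hT : T ∈ HalfIntegralPosDef n) :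
    U.map (Int.castRingHom ℝ) * T * (U.map (Int.castRingHom ℝ))ᵀ ∈ HalfIntegralPosDef n := by
  obtain ⟨hpos, hdiag, hoff⟩ := hT
  have hs : ∀ i j, T i j = T j i := fun i j => by simpa using (hpos.isHermitian.apply j i)
  choose d hd using hdiag
  choose m hm using hoff
  have happ : ∀ i j, (U.map (Int.castRingHom ℝ) * T * (U.map (Int.castRingHom ℝ))ᵀ) i j =
      ∑ l, ∑ k, (U i k : ℝ) * T k l * U j l := fun i j => by
    simp [mul_apply, Finset.sum_mul]
  refine ⟨posDef_conj hpos (isUnit_det_map hU), fun i => ?_, fun i j => ?_⟩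
  · have hsplit : ∑ l, ∑ k, (U i k : ℝ) * T k l * U i l =
        ∑ l, (U i l : ℝ) * T l l * U i l +
          ∑ l, ∑ k ∈ Finset.Iio l, (U i k : ℝ) * (2 * T k l) * U i l := by
      have h1 : ∀ f : Fin n → Fin n → ℝ, ∑ l, ∑ k, f k l = ∑ l, f l l +
          (∑ l, ∑ k ∈ Finset.Iio l, f k l + ∑ l, ∑ k ∈ Finset.Ioi l, f k l) := fun f => by
        simp only [← Finset.sum_add_distrib]
        refine Finset.sum_congr rfl fun l _ => ?_
        rw [← Finset.filter_gt_eq_Iio, ← Finset.filter_lt_eq_Ioi, Finset.sum_filter,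
          Finset.sum_filter, ← Finset.sum_add_distrib,
          ← Finset.add_sum_erase _ _ (Finset.mem_univ l),
          ← Finset.add_sum_erase (f := fun x => (if l > x then f x l else 0) + _) _ (Finset.mem_univ l)]
        simp only [gt_iff_lt, lt_self_iff_false, if_false, add_zero, zero_add]
        congr 1
        refine Finset.sum_congr rfl fun k hk => ?_
        rcases lt_or_gt_of_ne (Finset.ne_of_mem_erase hk) with h | h
        · simp [h, h.not_gt]
        · simp [h, h.not_gt]
      have h2 : ∀ f : Fin n → Fin n → ℝ, ∑ l, ∑ k ∈ Finset.Ioi l, f k l =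
          ∑ l, ∑ k ∈ Finset.Iio l, f l k := fun f => Finset.sum_comm' (by simp)
      rw [h1, h2, ← Finset.sum_add_distrib]
      congr 1
      refine Finset.sum_congr rfl fun l _ => ?_
      rw [← Finset.sum_add_distrib]
      refine Finset.sum_congr rfl fun k _ => ?_
      rw [hs l k]
      ring
    refine ⟨∑ l, U i l * d l * U i l + ∑ l, ∑ k ∈ Finset.Iio l, U i k * m k l * U i l, ?_⟩
    rw [happ, hsplit]
    push_cast
    simp only [hd, hm]
  · refine ⟨∑ l, ∑ k, U i k * m k l * U j l, ?_⟩
    rw [happ]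
    push_cast
    simp only [← hm, Finset.mul_sum]
    exact Finset.sum_congr rfl fun l _ => Finset.sum_congr rfl fun k _ => by ring

/-- The action of a unimodular matrix on half-integral positive definite matrices. -/
noncomputable def unimodularAct {n : ℕ} {U : Matrix (Fin n) (Fin n) ℤ} (hU : IsUnit U.det)
    (T : HalfIntegralPosDef n) : HalfIntegralPosDef n :=
  ⟨_, map_mem_halfIntegralPosDef hU T.2⟩

lemma unimodularAct_injective {n : ℕ} {U : Matrix (Fin n) (Fin n) ℤ} (hU : IsUnit U.det) :
    Function.Injective (unimodularAct hU) := fun T T' h => by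
  have hM := (isUnit_iff_isUnit_det _).2 (isUnit_det_map hU)
  have hMt : IsUnit (U.map (Int.castRingHom ℝ))ᵀ := by rwa [isUnit_transpose]
  exact Subtype.ext (hM.mul_left_cancel (hMt.mul_right_cancel (congrArg Subtype.val h)))

lemma term_le_prod {n : ℕ} {α β : ℝ} (hn : 1 ≤ n) (hα : 0 < α) (hβ : 0 < β)
    {Y : Matrix (Fin n) (Fin n) ℝ} (hY : Y.PosDef) {U : Matrix (Fin n) (Fin n) ℤ}
    (hU : IsUnit U.det) {g : Fin n → ℝ} (hg0 : ∀ i, 0 < g i)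
    (hg : ∀ i, g i = U.map (Int.castRingHom ℝ) i ⬝ᵥ Y⁻¹ *ᵥ U.map (Int.castRingHom ℝ) i)
    (T : HalfIntegralPosDef n) :
    T.val.det ^ α * Real.exp (-β * (T.val * Y).trace) ≤
      ∏ i, ((diagNat (unimodularAct hU T) i : ℝ) ^ α *
        Real.exp (-(β / n / g i * diagNat (unimodularAct hU T) i))) := by
  have hn0 : (0 : ℝ) < n := by exact_mod_cast hn
  rw [Finset.prod_mul_distrib, ← Real.exp_sum,
    Real.finsetProd_rpow _ _ fun i _ => Nat.cast_nonneg _]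
  have hdet : T.val.det ≤ ∏ i, (diagNat (unimodularAct hU T) i : ℝ) := by
    have h := det_le_prod_diag (unimodularAct hU T).2.1
    rw [show (unimodularAct hU T).val.det = T.val.det from det_conj_map hU T.val] at h
    simpa only [diagNat_cast] using h
  have hi : ∀ i, (diagNat (unimodularAct hU T) i : ℝ) / g i ≤ (T.val * Y).trace := fun i => by
    rw [div_le_iff₀ (hg0 i), diagNat_cast, mul_comm, hg]
    refine le_trans (le_of_eq ?_) (T.2.1.posSemidef.dotProduct_mulVec_le_mul_trace hY _)
    exact conj_apply_self _ _ _
  have hsum : ∑ i, (diagNat (unimodularAct hU T) i : ℝ) / g i ≤ n * (T.val * Y).trace := by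
    simpa using Finset.sum_le_sum fun i (_ : i ∈ Finset.univ) => hi i
  have hdet0 := T.2.1.det_pos
  gcongr
  have h : ∑ i, -(β / n / g i * (diagNat (unimodularAct hU T) i : ℝ)) =
      -(β / n) * ∑ i, (diagNat (unimodularAct hU T) i : ℝ) / g i := by
    rw [Finset.mul_sum]
    exact Finset.sum_congr rfl fun i _ => by ring
  rw [h]
  have h2 : β / n * ∑ i, (diagNat (unimodularAct hU T) i : ℝ) / g i ≤
      β / n * (n * (T.val * Y).trace) := by gcongr
  have h3 : β / n * (n * (T.val * Y).trace) = β * (T.val * Y).trace := by field_simp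
  linarith

lemma tsum_factor_le {n : ℕ} {α : ℝ} (hn : 1 ≤ n) (hα : 0 < α) {y : ℝ} (hy : 0 < y) :
    ∑' k : ℕ, ENNReal.ofReal (5 ^ n * √k ^ (n - 1)) *
        ENNReal.ofReal ((k : ℝ) ^ α * Real.exp (-(y * k))) ≤
      ENNReal.ofReal (5 ^ n * (2 * (2 * (α + (n - 1) / 2)) ^ (α + ((n : ℝ) - 1) / 2)) *
        y ^ (-(α + ((n : ℝ) + 1) / 2))) := by
  have hn1 : (1 : ℝ) ≤ n := by exact_mod_cast hn
  have hp : 0 < α + ((n : ℝ) - 1) / 2 := by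
    have : 0 ≤ ((n : ℝ) - 1) / 2 := by linarith
    linarith
  have hterm : ∀ k : ℕ, ENNReal.ofReal (5 ^ n * √k ^ (n - 1)) *
      ENNReal.ofReal ((k : ℝ) ^ α * Real.exp (-(y * k))) = ENNReal.ofReal (5 ^ n) *
        ENNReal.ofReal ((k : ℝ) ^ (α + ((n : ℝ) - 1) / 2) * Real.exp (-(y * k))) := fun k => by
    rw [← ENNReal.ofReal_mul (by positivity), ← ENNReal.ofReal_mul (by positivity)]
    congr 1
    rcases Nat.eq_zero_or_pos k with rfl | hk
    · simp [Real.zero_rpow hα.ne', Real.zero_rpow hp.ne']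
    · have hk' : (0 : ℝ) < k := by exact_mod_cast hk
      rw [Real.rpow_add hk', Real.sqrt_eq_rpow, ← Real.rpow_natCast (_ ^ _) (n - 1),
        ← Real.rpow_mul hk'.le, Nat.cast_sub hn, Nat.cast_one, show (1 : ℝ) / 2 * (n - 1) = (n - 1) / 2 by ring]
      ring
  rw [tsum_congr hterm, ENNReal.tsum_mul_left, mul_assoc, ENNReal.ofReal_mul (by positivity)]
  gcongr
  refine (tsum_rpow_mul_exp_le hp hy).trans_eq ?_
  congr 3
  ring

/-- For `n ≥ 1` and `α, β > 0` there is `C > 0`, depending only on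
`α`, `β`, `n`, such that for every real symmetric positive definite `Y`, the series
`∑_{T ∈ Λ_n^+} det(T)^α * exp(-β * tr(TY))` converges, with sum at most
`C * det(Y)^(-(α + (n+1)/2))`. -/
theorem stmt4 (n : ℕ) (hn : 1 ≤ n) (α β : ℝ) (hα : 0 < α) (hβ : 0 < β) :
    ∃ C : ℝ, 0 < C ∧ ∀ Y : Matrix (Fin n) (Fin n) ℝ, Y.PosDef →
      (Summable fun T : HalfIntegralPosDef n =>
        T.val.det ^ α * Real.exp (-β * (T.val * Y).trace)) ∧
      ∑' T : HalfIntegralPosDef n, T.val.det ^ α * Real.exp (-β * (T.val * Y).trace)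
        ≤ C * Y.det ^ (-(α + (n + 1) / 2)) := by
  obtain ⟨C, hC, hred⟩ := exists_unimodular_prod_le n
  have hn1 : (1 : ℝ) ≤ n := by exact_mod_cast hn
  have hn0 : (0 : ℝ) < n := by linarith
  have hp : 0 < α + ((n : ℝ) - 1) / 2 := by
    have : 0 ≤ ((n : ℝ) - 1) / 2 := by linarith
    linarith
  set s : ℝ := α + ((n : ℝ) + 1) / 2 with hs
  have hs0 : 0 < s := by positivity
  set K : ℝ := 5 ^ n * (2 * (2 * (α + (n - 1) / 2)) ^ (α + ((n : ℝ) - 1) / 2)) with hK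
  have hK0 : 0 < K := by positivity
  clear_value K
  refine ⟨(K * (β / n) ^ (-s)) ^ n * C ^ s, by positivity, fun Y hY => ?_⟩
  have hYdet := hY.det_pos
  obtain ⟨U, hU, hprod⟩ := hred _ hY.inv
  set g : Fin n → ℝ := fun i =>
    U.map (Int.castRingHom ℝ) i ⬝ᵥ Y⁻¹ *ᵥ U.map (Int.castRingHom ℝ) i with hg
  have hg0 : ∀ i, 0 < g i := fun i => by
    have h := (posDef_conj hY.inv (isUnit_det_map hU)).diag_pos (i := i)
    rwa [conj_apply_self] at h
  have hnonneg : ∀ T : HalfIntegralPosDef n,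
      0 ≤ T.val.det ^ α * Real.exp (-β * (T.val * Y).trace) := fun T =>
    mul_nonneg (Real.rpow_nonneg T.2.1.det_pos.le _) (Real.exp_pos _).le
  have hreal : ∏ i, (K * (β / n / g i) ^ (-s)) ≤
      (K * (β / n) ^ (-s)) ^ n * C ^ s * Y.det ^ (-s) := by
    have h1 : ∀ i, K * (β / n / g i) ^ (-s) = K * (β / n) ^ (-s) * g i ^ s := fun i => by
      rw [Real.div_rpow (by positivity) (hg0 i).le, Real.rpow_neg (hg0 i).le, div_inv_eq_mul,
        mul_assoc K]
    have h2 : ∏ i, g i ≤ C * Y.det⁻¹ := by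
      rwa [det_nonsing_inv, Ring.inverse_eq_inv'] at hprod
    rw [Finset.prod_congr rfl fun i _ => h1 i, Finset.prod_mul_distrib, Finset.prod_const,
      Finset.card_univ, Fintype.card_fin, Real.finsetProd_rpow _ _ fun i _ => (hg0 i).le,
      mul_assoc (_ ^ n), Real.rpow_neg hYdet.le, ← Real.inv_rpow hYdet.le,
      ← Real.mul_rpow hC.le (inv_nonneg.2 hYdet.le)]
    have h3 : 0 ≤ ∏ i, g i := Finset.prod_nonneg fun i _ => (hg0 i).le
    gcongr
  have hmain : ∑' T : HalfIntegralPosDef n,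
      ENNReal.ofReal (T.val.det ^ α * Real.exp (-β * (T.val * Y).trace)) ≤
        ENNReal.ofReal ((K * (β / n) ^ (-s)) ^ n * C ^ s * Y.det ^ (-s)) := by
    set F : Fin n → ℕ → ℝ≥0∞ := fun i k =>
      ENNReal.ofReal ((k : ℝ) ^ α * Real.exp (-(β / n / g i * k))) with hF
    calc _ ≤ ∑' T : HalfIntegralPosDef n, ∏ i, F i (diagNat (unimodularAct hU T) i) := by
          refine ENNReal.tsum_le_tsum fun T => ?_
          rw [← ENNReal.ofReal_prod_of_nonneg fun i _ => by positivity]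
          exact ENNReal.ofReal_le_ofReal
            (term_le_prod hn hα hβ hY hU hg0 (fun _ => rfl) T)
      _ ≤ ∑' T : HalfIntegralPosDef n, ∏ i, F i (diagNat T i) :=
          ENNReal.tsum_comp_le_tsum_of_injective (unimodularAct_injective hU)
            fun T => ∏ i, F i (diagNat T i)
      _ ≤ ∏ i, ∑' k : ℕ, ENNReal.ofReal (5 ^ n * √k ^ (n - 1)) * F i k :=
          tsum_prod_diagNat_le F
      _ ≤ ∏ i, ENNReal.ofReal (K * (β / n / g i) ^ (-s)) :=
          Finset.prod_le_prod' fun i _ =>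
            hK ▸ tsum_factor_le hn hα (div_pos (div_pos hβ hn0) (hg0 i))
      _ = ENNReal.ofReal (∏ i, (K * (β / n / g i) ^ (-s))) := by
          refine (ENNReal.ofReal_prod_of_nonneg fun i _ => ?_).symm
          exact mul_nonneg hK0.le
            (Real.rpow_nonneg (div_pos (div_pos hβ hn0) (hg0 i)).le _)
      _ ≤ _ := ENNReal.ofReal_le_ofReal hreal
  have hsum : Summable fun T : HalfIntegralPosDef n =>
      T.val.det ^ α * Real.exp (-β * (T.val * Y).trace) := by
    have h := ENNReal.summable_toReal (hmain.trans_lt ENNReal.ofReal_lt_top).ne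
    simpa only [ENNReal.toReal_ofReal (hnonneg _)] using h
  refine ⟨hsum, ?_⟩
  rw [← ENNReal.ofReal_tsum_of_nonneg hnonneg hsum] at hmain
  exact (ENNReal.ofReal_le_ofReal_iff (by positivity)).1 hmain
end

section
/- Let n ≥ 2 and N ≥ 1 be integers. Let Sp_{2n}(ℚ) = {g ∈ GL_{2n}(ℚ) : gᵀ J g = J}, where J = ((0, I_n), (−I_n, 0)). Let Γ_0^n(N) be the subgroup of elements of Sp_{2n}(ℚ) all of whose entries are integers and whose lower-left n×n block C satisfies N | C_{ij} for all i, j. Let P = P_{n,n−1}(ℚ) be the subgroup of all g ∈ Sp_{2n}(ℚ) which, written in n×n blocks g = ((A, B), (C, D)), satisfy: A_{i,n} = 0 for all 1 ≤ i ≤ n−1; C_{i,n} = 0 for all 1 ≤ i ≤ n−1; C_{n,j} = 0 for all 1 ≤ j ≤ n; and D_{n,j} = 0 for all 1 ≤ j ≤ n−1. Let R = ((M, 0), (0, M)) where M is the n×n matrix with M_{ij} = 1 if i + j = n+1 and M_{ij} = 0 otherwise. Then for every g ∈ Sp_{2n}(ℚ) there exist γ ∈ Γ_0^n(N) and p, p'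 ∈ P such that g = γ·p·R·p'. (Equivalently, every double coset in Γ_0^n(N)\Sp_{2n}(ℚ)/P_{n,n−1}(ℚ) has a representative in P_{n,n−1}(ℚ)·R.) -/
open Matrix

/-- The standard symplectic form matrix `J = ((0, I_n), (-I_n, 0))` over `ℚ`. -/
def Jmat (n : ℕ) : Matrix (Fin n ⊕ Fin n) (Fin n ⊕ Fin n) ℚ :=
  Matrix.fromBlocks 0 1 (-1) 0

/-- `g ∈ Sp_{2n}(ℚ)`, i.e. `gᵀ J g = J`. -/
def IsSymplectic (n : ℕ) (g : Matrix (Fin n ⊕ Fin n) (Fin n ⊕ Fin n) ℚ) : Prop :=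
  gᵀ * Jmat n * g = Jmat n

/-- `g ∈ Γ_0^n(N)`: `g` is symplectic, has integral entries, and its lower-left `n × n`
block `C` (rows indexed by `Sum.inr`, columns by `Sum.inl`) has all entries divisible
by `N`. -/
def InGamma0 (n N : ℕ) (g : Matrix (Fin n ⊕ Fin n) (Fin n ⊕ Fin n) ℚ) : Prop :=
  IsSymplectic n g ∧ (∀ i j, ∃ m : ℤ, g i j = m) ∧
    ∀ i j : Fin n, ∃ m : ℤ, g (Sum.inr i) (Sum.inl j) = (N : ℚ) * m

/-- `g ∈ P_{n,n-1}(ℚ)`: the Klingen parabolic.  Writing `g` in `n × n` blocks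
`((A, B), (C, D))`, with `1`-based indexing this says `A_{i,n} = 0` and `C_{i,n} = 0`
for `1 ≤ i ≤ n-1`, `C_{n,j} = 0` for all `j`, and `D_{n,j} = 0` for `1 ≤ j ≤ n-1`.
Here indices are `0`-based, so `n` becomes `n - 1` and `i ≤ n-1` becomes `i < n - 1`. -/
def InKlingenP (n : ℕ) (g : Matrix (Fin n ⊕ Fin n) (Fin n ⊕ Fin n) ℚ) : Prop :=
  IsSymplectic n g ∧
    (∀ i j : Fin n, (i : ℕ) < n - 1 → (j : ℕ) = n - 1 → g (Sum.inl i) (Sum.inl j) = 0) ∧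
    (∀ i j : Fin n, (i : ℕ) < n - 1 → (j : ℕ) = n - 1 → g (Sum.inr i) (Sum.inl j) = 0) ∧
    (∀ i j : Fin n, (i : ℕ) = n - 1 → g (Sum.inr i) (Sum.inl j) = 0) ∧
    (∀ i j : Fin n, (i : ℕ) = n - 1 → (j : ℕ) < n - 1 → g (Sum.inr i) (Sum.inr j) = 0)

/-- `R = ((M, 0), (0, M))` with `M` the anti-diagonal permutation matrix
(`M_{ij} = 1` iff `i + j = n + 1` with `1`-based indexing). -/
def Rmat (n : ℕ) : Matrix (Fin n ⊕ Fin n) (Fin n ⊕ Fin n) ℚ :=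
  Matrix.fromBlocks (Matrix.of fun i j : Fin n => if (i : ℕ) + (j : ℕ) = n - 1 then 1 else 0)
    0 0 (Matrix.of fun i j : Fin n => if (i : ℕ) + (j : ℕ) = n - 1 then 1 else 0)

/-- The symplectic form with Gram matrix `Jmat n`. -/
def sympForm (n : ℕ) (x y : Fin n ⊕ Fin n → ℚ) : ℚ := x ⬝ᵥ (Jmat n *ᵥ y)

lemma sympForm_eq_sum (n : ℕ) (x y : Fin n ⊕ Fin n → ℚ) :
    sympForm n x y = ∑ i, (x (.inl i) * y (.inr i) - x (.inr i) * y (.inl i)) := by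
  have hJ : Jmat n *ᵥ y = Sum.elim (fun i => y (.inr i)) (fun i => -y (.inl i)) := by
    rw [Jmat, fromBlocks_mulVec]
    simp [Function.comp_def, neg_mulVec]
    rfl
  simp [sympForm, hJ, dotProduct, sub_eq_add_neg, Finset.sum_add_distrib]

lemma sympForm_swap (n : ℕ) (x y : Fin n ⊕ Fin n → ℚ) :
    sympForm n x y = -sympForm n y x := by
  simp only [sympForm_eq_sum, ← Finset.sum_neg_distrib]
  exact Finset.sum_congr rfl fun i _ => by ring

lemma sympForm_add_left (n : ℕ) (x y z : Fin n ⊕ Fin n → ℚ) :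
    sympForm n (x + y) z = sympForm n x z + sympForm n y z := add_dotProduct ..

lemma sympForm_sub_left (n : ℕ) (x y z : Fin n ⊕ Fin n → ℚ) :
    sympForm n (x - y) z = sympForm n x z - sympForm n y z := sub_dotProduct ..

lemma sympForm_smul_left (n : ℕ) (a : ℚ) (x z : Fin n ⊕ Fin n → ℚ) :
    sympForm n (a • x) z = a * sympForm n x z := smul_dotProduct ..

lemma sympForm_add_right (n : ℕ) (x y z : Fin n ⊕ Fin n → ℚ) :
    sympForm n x (y + z) = sympForm n x y + sympForm n x z := by
  simp [sympForm, mulVec_add]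

lemma sympForm_smul_right (n : ℕ) (a : ℚ) (x z : Fin n ⊕ Fin n → ℚ) :
    sympForm n x (a • z) = a * sympForm n x z := by
  simp [sympForm, mulVec_smul]

lemma sympForm_self (n : ℕ) (x : Fin n ⊕ Fin n → ℚ) : sympForm n x x = 0 := by
  linarith [sympForm_swap n x x]

@[simp]
lemma sympForm_single_inl (n : ℕ) (i : Fin n) (y : Fin n ⊕ Fin n → ℚ) :
    sympForm n (Pi.single (.inl i) 1) y = y (.inr i) := by
  simp [sympForm_eq_sum, Pi.single_apply]

@[simp]
lemma sympForm_single_inr (n : ℕ) (i : Fin n) (y : Fin n ⊕ Fin n → ℚ) :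
    sympForm n (Pi.single (.inr i) 1) y = -y (.inl i) := by
  simp [sympForm_eq_sum, Pi.single_apply]

lemma isSymplectic_iff {n : ℕ} {g : Matrix (Fin n ⊕ Fin n) (Fin n ⊕ Fin n) ℚ} :
    IsSymplectic n g ↔ ∀ x y, sympForm n (g *ᵥ x) (g *ᵥ y) = sympForm n x y := by
  have key : ∀ x y, sympForm n (g *ᵥ x) (g *ᵥ y) = x ⬝ᵥ ((gᵀ * Jmat n * g) *ᵥ y) := by
    intro x y
    rw [sympForm, ← mulVec_mulVec, ← mulVec_mulVec, dotProduct_mulVec x, vecMul_transpose]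
  constructor
  · intro h x y
    rw [key, h, sympForm]
  · intro h
    ext i j
    have hij := h (Pi.single i 1) (Pi.single j 1)
    rw [key, sympForm] at hij
    simpa using hij

lemma IsSymplectic.mul {n : ℕ} {g h : Matrix (Fin n ⊕ Fin n) (Fin n ⊕ Fin n) ℚ}
    (hg : IsSymplectic n g) (hh : IsSymplectic n h) : IsSymplectic n (g * h) := by
  rw [isSymplectic_iff] at *
  intro x y
  rw [← mulVec_mulVec, ← mulVec_mulVec, hg, hh]

lemma IsSymplectic.exists_inv {n : ℕ} {g : Matrix (Fin n ⊕ Fin n) (Fin n ⊕ Fin n) ℚ}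
    (hg : IsSymplectic n g) : ∃ h, IsSymplectic n h ∧ g * h = 1 ∧ h * g = 1 := by
  have hJ : Jmat n * Jmat n = -1 := by
    simp [Jmat, fromBlocks_multiply, ← fromBlocks_one, fromBlocks_neg]
  have h1 : (-(Jmat n * gᵀ * Jmat n)) * g = 1 := by
    rw [neg_mul, Matrix.mul_assoc, Matrix.mul_assoc, ← Matrix.mul_assoc gᵀ,
      show gᵀ * Jmat n * g = Jmat n from hg, hJ, neg_neg]
  have h2 := mul_eq_one_comm.mp h1
  refine ⟨_, isSymplectic_iff.mpr fun x y => ?_, h2, h1⟩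
  rw [← isSymplectic_iff.mp hg, mulVec_mulVec, mulVec_mulVec, h2, one_mulVec, one_mulVec]

lemma isSymplectic_fromBlocks_diagonal {n : ℕ} {A D : Matrix (Fin n) (Fin n) ℚ}
    (h : Aᵀ * D = 1) : IsSymplectic n (fromBlocks A 0 0 D) := by
  have h' : Dᵀ * A = 1 := by simpa using congrArg transpose h
  simp [IsSymplectic, Jmat, fromBlocks_transpose, fromBlocks_multiply, h, h']

lemma inKlingenP_of_mulVec_single {n : ℕ} {l : Fin n} (hl : (l : ℕ) = n - 1)
    {p : Matrix (Fin n ⊕ Fin n) (Fin n ⊕ Fin n) ℚ} (hp : IsSymplectic n p)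
    (h : p *ᵥ Pi.single (.inl l) 1 = Pi.single (.inl l) 1) : InKlingenP n p := by
  have hcol (k) : p k (.inl l) = (Pi.single (.inl l) 1 : Fin n ⊕ Fin n → ℚ) k := by
    simpa using congrFun h k
  have hrow (k) : p (.inr l) k = (Pi.single k 1 : Fin n ⊕ Fin n → ℚ) (.inr l) := by
    have hk := isSymplectic_iff.mp hp (Pi.single (.inl l) 1) (Pi.single k 1)
    rw [h, sympForm_single_inl, sympForm_single_inl] at hk
    simpa using hk
  have heq (j : Fin n) (hj : (j : ℕ) = n - 1) : j = l := Fin.ext (hj.trans hl.symm)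
  refine ⟨hp, fun i j hi hj => ?_, fun i j hi hj => ?_, fun i j hi => ?_, fun i j hi hj => ?_⟩
  · rw [heq j hj, hcol, Pi.single_eq_of_ne]
    rintro ⟨⟩
    omega
  · rw [heq j hj, hcol, Pi.single_eq_of_ne (by simp)]
  · rw [heq i hi, hrow, Pi.single_eq_of_ne (by simp)]
  · rw [heq i hi, hrow, Pi.single_eq_of_ne]
    rintro ⟨⟩
    omega

/-- A symplectic transvection moves `x` to `y` as soon as the two vectors are not orthogonal,
and it fixes every vector pairing equally with `x` and `y`. -/
lemma exists_isSymplectic_mulVec_eq_of_sympForm_ne_zero {n : ℕ} {x y : Fin n ⊕ Fin n → ℚ}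
    (hxy : sympForm n y x ≠ 0) :
    ∃ p, IsSymplectic n p ∧ p *ᵥ x = y ∧
      ∀ z, sympForm n z x = sympForm n z y → p *ᵥ z = z := by
  set u := y - x with hu
  set t := (sympForm n y x)⁻¹ with ht
  have hT (z) : (1 + t • vecMulVec u (u ᵥ* Jmat n)) *ᵥ z = z + (t * sympForm n u z) • u := by
    rw [add_mulVec, one_mulVec, smul_mulVec, vecMulVec_mulVec, sympForm, dotProduct_mulVec,
      op_smul_eq_smul, smul_smul]
  refine ⟨1 + t • vecMulVec u (u ᵥ* Jmat n), isSymplectic_iff.mpr fun z w => ?_, ?_,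
    fun z hz => ?_⟩
  · rw [hT, hT]
    simp only [sympForm_add_left, sympForm_add_right, sympForm_smul_left, sympForm_smul_right,
      sympForm_self, sympForm_swap n z u]
    ring
  · rw [hT, hu, sympForm_sub_left, sympForm_self, sub_zero, ht, inv_mul_cancel₀ hxy]
    simp
  · rw [hT, hu, sympForm_sub_left, sympForm_swap n y, sympForm_swap n x, hz]
    simp

lemma exists_isSymplectic_fixing {n : ℕ} {i l : Fin n} (hil : i ≠ l)
    {w : Fin n ⊕ Fin n → ℚ} (hw : w (.inr l) = 0) (hk : ∃ k, k ≠ .inl l ∧ w k ≠ 0) :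
    ∃ p, IsSymplectic n p ∧ p *ᵥ Pi.single (.inl i) 1 = w ∧
      p *ᵥ Pi.single (.inl l) 1 = Pi.single (.inl l) 1 := by
  obtain ⟨z, hz, hzi, hzw⟩ : ∃ z : Fin n ⊕ Fin n → ℚ,
      z (.inr l) = 0 ∧ z (.inr i) ≠ 0 ∧ sympForm n w z ≠ 0 := by
    obtain ⟨y, hy, hyw⟩ : ∃ y : Fin n ⊕ Fin n → ℚ, y (.inr l) = 0 ∧ sympForm n w y ≠ 0 := by
      obtain ⟨k | k, hkl, hwk⟩ := hk
      · refine ⟨Pi.single (.inr k) 1, Pi.single_eq_of_ne ?_ _, ?_⟩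
        · rintro ⟨⟩
          exact hkl rfl
        · rw [sympForm_swap]
          simpa using hwk
      · refine ⟨Pi.single (.inl k) 1, by simp, ?_⟩
        rw [sympForm_swap]
        simpa using hwk
    have hfl : (Pi.single (.inr i) 1 : Fin n ⊕ Fin n → ℚ) (.inr l) = 0 :=
      Pi.single_eq_of_ne (by simpa using hil.symm) _
    by_cases hf : sympForm n w (Pi.single (.inr i) 1) = 0
    · by_cases hyi : y (.inr i) = 0
      · exact ⟨Pi.single (.inr i) 1 + y, by simp [hfl, hy], by simp [hyi],
          by simpa [sympForm_add_right, hf] using hyw⟩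
      · exact ⟨y, hy, hyi, hyw⟩
    · exact ⟨Pi.single (.inr i) 1, hfl, by simp, hf⟩
  obtain ⟨p, hp, hpz, hpl⟩ :=
    exists_isSymplectic_mulVec_eq_of_sympForm_ne_zero (x := Pi.single (.inl i) 1) (y := z)
      (by rw [sympForm_swap]; simpa using hzi)
  obtain ⟨q, hq, hqw, hql⟩ := exists_isSymplectic_mulVec_eq_of_sympForm_ne_zero hzw
  refine ⟨q * p, hq.mul hp, by rw [← mulVec_mulVec, hpz, hqw], ?_⟩
  rw [← mulVec_mulVec, hpl _ (by simp [hz]), hql _ (by simp [hz, hw])]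

lemma Rmat_eq_fromBlocks (n : ℕ) : ∃ M : Matrix (Fin n) (Fin n) ℚ,
    Rmat n = fromBlocks M 0 0 M ∧ ∀ i j, M i j = if j = i.rev then 1 else 0 := by
  refine ⟨_, rfl, fun i j => ?_⟩
  simp only [of_apply, Fin.ext_iff, Fin.val_rev]
  congr 1
  exact propext (by omega)

lemma isSymplectic_Rmat (n : ℕ) : IsSymplectic n (Rmat n) := by
  obtain ⟨M, hR, hM⟩ := Rmat_eq_fromBlocks n
  rw [hR]
  apply isSymplectic_fromBlocks_diagonal
  ext i j
  have hrev (x : Fin n) : i = x.rev ↔ x = i.rev := by rw [eq_comm, Fin.rev_eq_iff]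
  simp only [mul_apply, transpose_apply, hM, hrev, ite_mul, one_mul, zero_mul, Finset.sum_ite_eq',
    Finset.mem_univ, if_true, Fin.rev_rev, one_apply, eq_comm]

lemma Rmat_mulVec (n : ℕ) (x : Fin n ⊕ Fin n → ℚ) :
    Rmat n *ᵥ x = x ∘ Sum.map Fin.rev Fin.rev := by
  obtain ⟨M, hR, hM⟩ := Rmat_eq_fromBlocks n
  rw [hR, fromBlocks_mulVec]
  ext (i | i) <;> simp [mulVec, dotProduct, hM]

lemma inGamma0_fromBlocks_diagonal {n : ℕ} (N : ℕ) {A D : Matrix (Fin n) (Fin n) ℚ}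
    (h : Aᵀ * D = 1) (hA : ∀ i j, ∃ m : ℤ, A i j = m) (hD : ∀ i j, ∃ m : ℤ, D i j = m) :
    InGamma0 n N (fromBlocks A 0 0 D) := by
  refine ⟨isSymplectic_fromBlocks_diagonal h, ?_, fun i j => ⟨0, by simp⟩⟩
  rintro (i | i) (j | j)
  · simpa using hA i j
  · exact ⟨0, by simp⟩
  · exact ⟨0, by simp⟩
  · simpa using hD i j

lemma inGamma0_Rmat (n N : ℕ) : InGamma0 n N (Rmat n) := by
  refine ⟨isSymplectic_Rmat n, ?_, fun i j => ⟨0, by simp [Rmat]⟩⟩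
  obtain ⟨M, hR, hM⟩ := Rmat_eq_fromBlocks n
  have hint (i j) : ∃ m : ℤ, M i j = m := ⟨if j = i.rev then 1 else 0, by simp [hM]⟩
  rw [hR]
  rintro (i | i) (j | j)
  · simpa using hint i j
  · exact ⟨0, by simp⟩
  · exact ⟨0, by simp⟩
  · simpa using hint i j

/-- The `2 × 2` matrix `((a, b), (c, d))` placed in rows and columns `i`, `l`, and extended by the
identity. -/
def embedTwo {n : ℕ} (i l : Fin n) (a b c d : ℤ) : Matrix (Fin n) (Fin n) ℤ :=
  1 + single i i (a - 1) + single i l b + single l i c + single l l (d - 1)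

lemma embedTwo_mul {n : ℕ} {i l : Fin n} (hil : i ≠ l) {a b c d : ℤ} (h : a * d - b * c = 1) :
    embedTwo i l a b c d * embedTwo i l d (-b) (-c) a = 1 := by
  have hexp : embedTwo i l a b c d * embedTwo i l d (-b) (-c) a =
      1 + single i i (a * d - b * c - 1) + single l l (a * d - b * c - 1) := by
    simp only [embedTwo, add_mul, mul_add, one_mul, mul_one, single_mul_single_same,
      single_mul_single_of_ne _ _ _ _ hil, single_mul_single_of_ne _ _ _ _ hil.symm]
    ext s t
    simp only [Matrix.add_apply, single_apply, Matrix.zero_apply]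
    split_ifs <;> ring
  rw [hexp, h]
  simp

lemma embedTwo_mulVec {n : ℕ} (i l : Fin n) (a b c d : ℤ) (x : Fin n → ℚ) :
    (embedTwo i l a b c d).map (Int.cast : ℤ → ℚ) *ᵥ x =
      x + Pi.single i ((a - 1) * x i + b * x l) + Pi.single l (c * x i + (d - 1) * x l) := by
  have hmap : (embedTwo i l a b c d).map (Int.cast : ℤ → ℚ) = 1 + single i i ((a : ℚ) - 1) +
      single i l (b : ℚ) + single l i (c : ℚ) + single l l ((d : ℚ) - 1) := by
    ext s t
    simp [embedTwo, one_apply, single_apply]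
  rw [hmap]
  simp only [add_mulVec, one_mulVec, single_mulVec]
  ext s
  simp only [Pi.add_apply, Pi.single_apply, Function.update_apply, Pi.zero_apply]
  split_ifs <;> ring

lemma exists_inGamma0_mulVec_eq {n : ℕ} (N : ℕ) {i l : Fin n} (hi : (i : ℕ) = 0)
    (hl : (l : ℕ) = n - 1) (hil : i ≠ l) {v : Fin n ⊕ Fin n → ℚ} (hv : v ≠ 0) :
    ∃ γ w, InGamma0 n N γ ∧ γ *ᵥ w = v ∧ w (.inr l) = 0 ∧ ∃ k, k ≠ .inl l ∧ w k ≠ 0 := by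
  by_cases hvl : v (.inr l) = 0
  · by_cases hk : ∃ k, k ≠ .inl l ∧ v k ≠ 0
    · refine ⟨1, v, ?_, one_mulVec v, hvl, hk⟩
      rw [← fromBlocks_one]
      have hone (i j : Fin n) : ∃ m : ℤ, (1 : Matrix (Fin n) (Fin n) ℚ) i j = m :=
        ⟨if i = j then 1 else 0, by simp [one_apply]⟩
      exact inGamma0_fromBlocks_diagonal N (by simp) hone hone
    · push Not at hk
      have hrev : l.rev = i := Fin.ext (by rw [Fin.val_rev]; omega)
      refine ⟨Rmat n, Rmat n *ᵥ v, inGamma0_Rmat n N, ?_, ?_, .inl i, by simpa using hil, ?_⟩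
      · ext (s | s) <;> simp [Rmat_mulVec]
      · simpa [Rmat_mulVec, hrev] using hk (.inr i) (by simp)
      · simp only [Rmat_mulVec, Function.comp_apply, Sum.map_inl, ← hrev, Fin.rev_rev]
        intro h0
        refine hv (funext fun k => ?_)
        by_cases hkl : k = .inl l
        · rw [hkl, h0, Pi.zero_apply]
        · exact hk k hkl
  · set c : ℚ := v (.inr i) / v (.inr l) with hc
    obtain ⟨a, b, hab⟩ : IsCoprime c.num (c.den : ℤ) :=
      Int.isCoprime_iff_gcd_eq_one.mpr c.reduced
    have hcd : (c.den : ℚ) * v (.inr i) = c.num * v (.inr l) := by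
      have hden : (c.den : ℚ) ≠ 0 := by simp
      have h := Rat.num_div_den c
      rw [div_eq_iff hden, hc, div_mul_eq_mul_div, eq_div_iff hvl] at h
      linarith
    have hDE := embedTwo_mul hil (a := -a) (b := -b) (c := c.den) (d := -c.num) (by linarith)
    set D := (embedTwo i l (-a) (-b) c.den (-c.num)).map (Int.cast : ℤ → ℚ) with hD
    set E := (embedTwo i l (-c.num) (- -b) (-c.den) (-a)).map (Int.cast : ℤ → ℚ) with hE
    have hDE1 : D * E = 1 := by
      refine (Matrix.map_mul (f := Int.castRingHom ℚ)).symm.trans ?_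
      rw [hDE]
      simp
    have hED1 : E * D = 1 := mul_eq_one_comm.mp hDE1
    have hw (k) : (fromBlocks Eᵀ 0 0 D *ᵥ v) (.inr k) = (D *ᵥ (v ∘ Sum.inr)) k := by
      simp [fromBlocks_mulVec]
    refine ⟨fromBlocks Dᵀ 0 0 E, fromBlocks Eᵀ 0 0 D *ᵥ v,
      inGamma0_fromBlocks_diagonal N (by simpa using hDE1) (fun s t => ⟨_, rfl⟩)
        (fun s t => ⟨_, rfl⟩), ?_, ?_, .inr i, by simp, ?_⟩
    · simp [mulVec_mulVec, fromBlocks_multiply, ← transpose_mul, hED1]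
    · rw [hw, hD, embedTwo_mulVec]
      simp [hil.symm]
      linarith
    · rw [hw, hD, embedTwo_mulVec]
      simp [hil]
      intro h0
      have habq : (a : ℚ) * c.num + b * c.den = 1 := mod_cast hab
      apply hvl
      linear_combination (-v (.inr l)) * habq - c.den * h0 - a * hcd

/-- For `n ≥ 2`, `N ≥ 1`, every `g ∈ Sp_{2n}(ℚ)` can be written as
`g = γ · p · R · p'` with `γ ∈ Γ_0^n(N)` and `p, p' ∈ P_{n,n-1}(ℚ)`; i.e. every double
coset in `Γ_0^n(N) \ Sp_{2n}(ℚ) / P_{n,n-1}(ℚ)` has a representative in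
`P_{n,n-1}(ℚ) · R`. -/
theorem stmt7 (n N : ℕ) (hn : 2 ≤ n) (hN : 1 ≤ N)
    (g : Matrix (Fin n ⊕ Fin n) (Fin n ⊕ Fin n) ℚ) (hg : IsSymplectic n g) :
    ∃ γ p p' : Matrix (Fin n ⊕ Fin n) (Fin n ⊕ Fin n) ℚ,
      InGamma0 n N γ ∧ InKlingenP n p ∧ InKlingenP n p' ∧ g = γ * p * Rmat n * p' := by
  obtain ⟨i, hi⟩ : ∃ i : Fin n, (i : ℕ) = 0 := ⟨⟨0, by omega⟩, rfl⟩
  obtain ⟨l, hl⟩ : ∃ l : Fin n, (l : ℕ) = n - 1 := ⟨⟨n - 1, by omega⟩, rfl⟩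
  have hil : i ≠ l := by
    rintro rfl
    omega
  obtain ⟨γ, w, hγ, hγw, hwl, hwk⟩ := exists_inGamma0_mulVec_eq N hi hl hil
    (v := g *ᵥ Pi.single (.inl l) 1) (by
      intro h0
      have h := isSymplectic_iff.mp hg (Pi.single (.inl l) 1) (Pi.single (.inr l) 1)
      rw [h0] at h
      simp [sympForm, Jmat] at h)
  obtain ⟨p, hp, hpw, hpl⟩ := exists_isSymplectic_fixing hil hwl hwk
  have hq := (hγ.1.mul hp).mul (isSymplectic_Rmat n)
  obtain ⟨q, hqs, hq1, hq2⟩ := hq.exists_inv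
  have hRl : Rmat n *ᵥ Pi.single (.inl l) 1 = Pi.single (.inl i) 1 := by
    have hrev : l.rev = i := Fin.ext (by rw [Fin.val_rev]; omega)
    rw [Rmat_mulVec]
    ext (s | s)
    · simp [Pi.single_apply, ← hrev, Fin.rev_eq_iff]
    · simp
  refine ⟨γ, p, q * g, hγ, inKlingenP_of_mulVec_single hl hp hpl,
    inKlingenP_of_mulVec_single hl (hqs.mul hg) ?_, ?_⟩
  · have h : (γ * p * Rmat n) *ᵥ Pi.single (.inl l) 1 = g *ᵥ Pi.single (.inl l) 1 := by
      rw [← mulVec_mulVec, hRl, ← mulVec_mulVec, hpw, hγw]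
    rw [← mulVec_mulVec, ← h, mulVec_mulVec, hq2, one_mulVec]
  · rw [← Matrix.mul_assoc, hq1, Matrix.one_mul]
end

section
/- Let k ≥ 2 be an integer and let s be a complex number with Re(s) > 2k−1. Then the Dirichlet series ∑_{n=1}^{∞} σ_{k−1}(n)²/n^s converges and equals ζ(s)·ζ(s−k+1)²·ζ(s−2k+2) / ζ(2s−2k+2), where ζ is the Riemann zeta function. (This is the Rankin–Selberg L-series of the weight-k Eisenstein series, whose n-th Fourier coefficient is proportional to σ_{k−1}(n) for n ≥ 1.) -/
open Complex

open ArithmeticFunction in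
lemma sigma_le_pow_mul_one_add_log {a : ℕ} (ha : 1 ≤ a) (n : ℕ) :
    (sigma a n : ℝ) ≤ (n : ℝ) ^ a * (1 + Real.log n) := by
  have hH : ∑ d ∈ n.divisors, (d : ℝ)⁻¹ ≤ 1 + Real.log n := by
    refine le_trans ?_ (harmonic_le_one_add_log n)
    rw [harmonic_eq_sum_Icc]
    push_cast
    refine Finset.sum_le_sum_of_subset_of_nonneg (fun d hd => ?_) (fun _ _ _ => by positivity)
    exact Finset.mem_Icc.mpr ⟨Nat.pos_of_mem_divisors hd, Nat.divisor_le hd⟩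
  refine le_trans ?_ (mul_le_mul_of_nonneg_left hH (by positivity))
  rw [sigma_eq_sum_div, Finset.mul_sum]
  push_cast
  refine Finset.sum_le_sum fun d hd => ?_
  have hd1 : (1 : ℝ) ≤ d := by exact_mod_cast Nat.pos_of_mem_divisors hd
  rw [Nat.cast_div (Nat.dvd_of_mem_divisors hd) (by positivity), div_pow, div_eq_mul_inv]
  gcongr
  exact le_self_pow₀ hd1 (by omega)

open ArithmeticFunction in
lemma LSeriesSummable_sigma_sq {a : ℕ} (ha : 1 ≤ a) {s : ℂ} (hs : 2 * (a : ℝ) + 1 < s.re) :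
    LSeriesSummable (fun n => (sigma a n : ℂ) ^ 2) s := by
  obtain ⟨ε, hε, hεs⟩ : ∃ ε : ℝ, 0 < ε ∧ 2 * (a : ℝ) + 1 + 2 * ε < s.re :=
    ⟨(s.re - (2 * a + 1)) / 4, by linarith, by linarith⟩
  refine LSeriesSummable_of_le_const_mul_rpow hεs ⟨(1 + 1 / ε) ^ 2, fun n hn => ?_⟩
  have hn1 : (1 : ℝ) ≤ n := by exact_mod_cast Nat.pos_of_ne_zero hn
  have hn0 : (0 : ℝ) < n := by linarith
  have hlog : 1 + Real.log n ≤ (1 + 1 / ε) * (n : ℝ) ^ ε := by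
    have h1 := Real.log_le_rpow_div hn0.le hε
    have h2 := Real.one_le_rpow hn1 hε.le
    rw [add_mul, one_mul, one_div_mul_eq_div]
    linarith
  have hσ : (sigma a n : ℝ) ≤ (n : ℝ) ^ a * ((1 + 1 / ε) * (n : ℝ) ^ ε) :=
    (sigma_le_pow_mul_one_add_log ha n).trans (by gcongr)
  have hpow : (n : ℝ) ^ (2 * (a : ℝ) + 1 + 2 * ε - 1) = ((n : ℝ) ^ a * (n : ℝ) ^ ε) ^ 2 := by
    rw [← Real.rpow_natCast n a, ← Real.rpow_add hn0, ← Real.rpow_mul_natCast hn0.le]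
    congr 1
    push_cast
    ring
  rw [norm_pow, Complex.norm_natCast, hpow, ← mul_pow]
  gcongr
  linarith

/-- The local factor at a prime of the Rankin–Selberg Euler product. -/
lemma tsum_geom_sum_sq_mul_pow {x t : ℂ} (hx : x ≠ 1) (h0 : ‖t‖ < 1) (h1 : ‖x * t‖ < 1)
    (h2 : ‖x ^ 2 * t‖ < 1) :
    ∑' e : ℕ, (∑ i ∈ Finset.range (e + 1), x ^ i) ^ 2 * t ^ e =
      (1 - x ^ 2 * t ^ 2) * ((1 - t)⁻¹ * (1 - x * t)⁻¹ ^ 2 * (1 - x ^ 2 * t)⁻¹) := by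
  have hx' : x - 1 ≠ 0 := sub_ne_zero.mpr hx
  have ne {y : ℂ} (hy : ‖y‖ < 1) : 1 - y ≠ 0 := by
    rintro h
    rw [← sub_eq_zero.mp h] at hy
    simp at hy
  have n0 := ne h0
  have n1 := ne h1
  have n2 := ne h2
  have H := (((hasSum_geometric_of_norm_lt_one h2).mul_left (x ^ 2)).sub
    ((hasSum_geometric_of_norm_lt_one h1).mul_left (2 * x))).add
    (hasSum_geometric_of_norm_lt_one h0) |>.mul_left (((x - 1) ^ 2)⁻¹)
  convert! H.tsum_eq using 1
  · refine tsum_congr fun e => ?_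
    rw [geom_sum_eq hx]
    field_simp
    ring
  · field_simp
    ring

open ArithmeticFunction in
lemma tsum_sigma_sq_term_prime_pow {a : ℕ} (ha : 1 ≤ a) {s : ℂ} (hs : 2 * (a : ℝ) + 1 < s.re)
    {p : ℕ} (hp : p.Prime) :
    ∑' e : ℕ, LSeries.term (fun n => (sigma a n : ℂ) ^ 2) s (p ^ e) =
      (1 - (p : ℂ) ^ (-(2 * (s - a)))) * ((1 - (p : ℂ) ^ (-s))⁻¹ *
        (1 - (p : ℂ) ^ (-(s - a)))⁻¹ ^ 2 * (1 - (p : ℂ) ^ (-(s - 2 * a)))⁻¹) := by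
  have hp0 : (p : ℂ) ≠ 0 := by exact_mod_cast hp.ne_zero
  have ha' : (1 : ℝ) ≤ a := by exact_mod_cast ha
  have lt {w : ℂ} (hw : 0 < w.re) : ‖(p : ℂ) ^ (-w)‖ < 1 := by
    rw [norm_natCast_cpow_of_pos hp.pos]
    exact Real.rpow_lt_one_of_one_lt_of_neg (by exact_mod_cast hp.one_lt) (by simpa using hw)
  have e1 : (p : ℂ) ^ (-(s - a)) = (p : ℂ) ^ a * (p : ℂ) ^ (-s) := by
    rw [← cpow_natCast, ← cpow_add _ _ hp0]; congr 1; ring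
  have e2 : (p : ℂ) ^ (-(s - 2 * a)) = ((p : ℂ) ^ a) ^ 2 * (p : ℂ) ^ (-s) := by
    rw [← pow_mul, ← cpow_natCast, ← cpow_add _ _ hp0]; congr 1; push_cast; ring
  have e3 : (p : ℂ) ^ (-(2 * (s - a))) = ((p : ℂ) ^ a) ^ 2 * ((p : ℂ) ^ (-s)) ^ 2 := by
    rw [← mul_pow, ← e1, ← cpow_nat_mul]; congr 1; push_cast; ring
  rw [e3, e1, e2, ← tsum_geom_sum_sq_mul_pow]
  · refine tsum_congr fun e => ?_
    rw [LSeries.term_of_ne_zero (pow_ne_zero _ hp.ne_zero), sigma_apply_prime_pow hp,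
      div_eq_mul_inv, ← cpow_neg, Nat.cast_pow, ← natCast_cpow_natCast_mul, ← cpow_nat_mul]
    push_cast
    simp_rw [← pow_mul, mul_comm a]
  · exact_mod_cast (Nat.one_lt_pow (by omega) hp.one_lt).ne'
  · exact lt (by linarith)
  · rw [← e1]; exact lt (by simp; linarith)
  · rw [← e2]; exact lt (by simp; linarith)

open ArithmeticFunction in
/-- The Dirichlet series of `σ_a²` is given by Ramanujan's formula. -/
theorem LSeries_sigma_sq {a : ℕ} (ha : 1 ≤ a) {s : ℂ} (hs : 2 * (a : ℝ) + 1 < s.re) :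
    LSeries (fun n => (sigma a n : ℂ) ^ 2) s =
      riemannZeta s * riemannZeta (s - a) ^ 2 * riemannZeta (s - 2 * a) /
        riemannZeta (2 * (s - a)) := by
  have ha' : (1 : ℝ) ≤ a := by exact_mod_cast ha
  have h0 : 1 < s.re := by linarith
  have h1 : 1 < (s - a).re := by simp; linarith
  have h2 : 1 < (s - 2 * a).re := by simp; linarith
  have h3 : 1 < (2 * (s - a)).re := by simp; linarith
  have hL : HasProd (fun p : Nat.Primes =>
      ∑' e : ℕ, LSeries.term (fun n => (sigma a n : ℂ) ^ 2) s (p ^ e))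
      (LSeries (fun n => (sigma a n : ℂ) ^ 2) s) := by
    refine EulerProduct.eulerProduct_hasProd ?_ ?_ (LSeriesSummable_sigma_sq ha hs).norm ?_
    · simp [LSeries.term]
    · intro m n hmn
      rcases eq_or_ne m 0 with rfl | hm
      · simp
      rcases eq_or_ne n 0 with rfl | hn
      · simp
      rw [LSeries.term_of_ne_zero (mul_ne_zero hm hn), LSeries.term_of_ne_zero hm,
        LSeries.term_of_ne_zero hn, isMultiplicative_sigma.map_mul_of_coprime hmn, Nat.cast_mul,
        Nat.cast_mul, natCast_mul_natCast_cpow, mul_pow, mul_div_mul_comm]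
    · simp
  have hZ := ((riemannZeta_eulerProduct_hasProd h0).mul
    ((riemannZeta_eulerProduct_hasProd h1).mul (riemannZeta_eulerProduct_hasProd h1))).mul
    (riemannZeta_eulerProduct_hasProd h2)
  rw [eq_div_iff (riemannZeta_ne_zero_of_one_lt_re h3), pow_two]
  refine (hL.mul (riemannZeta_eulerProduct_hasProd h3)).unique ?_
  convert! hZ using 2 with p
  have hne : 1 - (p : ℂ) ^ (-(2 * (s - a))) ≠ 0 := by
    intro h
    have hlt : ‖(p : ℂ) ^ (-(2 * (s - a)))‖ < 1 := by
      rw [norm_natCast_cpow_of_pos p.2.pos]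
      exact Real.rpow_lt_one_of_one_lt_of_neg (by exact_mod_cast p.2.one_lt)
        (by rw [neg_re]; linarith)
    rw [← sub_eq_zero.mp h] at hlt
    simp at hlt
  rw [tsum_sigma_sq_term_prime_pow ha hs p.2, mul_right_comm, mul_inv_cancel₀ hne, one_mul, pow_two]

/-- For an integer `k ≥ 2` and `s ∈ ℂ` with `Re(s) > 2k - 1`, the
Dirichlet series `∑_{n ≥ 1} σ_{k-1}(n)² / n^s` converges and equals
`ζ(s)·ζ(s-k+1)²·ζ(s-2k+2) / ζ(2s-2k+2)`, where `σ_{k-1}(n) = ∑_{d ∣ n} d^{k-1}`. -/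
theorem stmt9 (k : ℕ) (hk : 2 ≤ k) (s : ℂ) (hs : (2 * (k : ℝ) - 1) < s.re) :
    (Summable fun n : ℕ+ =>
      ((∑ d ∈ Nat.divisors (n : ℕ), (d : ℂ) ^ (k - 1)) ^ 2) / (n : ℂ) ^ s) ∧
    ∑' n : ℕ+, ((∑ d ∈ Nat.divisors (n : ℕ), (d : ℂ) ^ (k - 1)) ^ 2) / (n : ℂ) ^ s =
      riemannZeta s * riemannZeta (s - k + 1) ^ 2 * riemannZeta (s - 2 * k + 2) /
        riemannZeta (2 * s - 2 * k + 2) := by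
  obtain ⟨a, rfl⟩ : ∃ a, k = a + 1 := ⟨k - 1, by omega⟩
  have ha : 1 ≤ a := by omega
  have hs' : 2 * (a : ℝ) + 1 < s.re := by push_cast at hs; linarith
  have hterm (n : ℕ+) : (∑ d ∈ Nat.divisors (n : ℕ), (d : ℂ) ^ (a + 1 - 1)) ^ 2 / (n : ℂ) ^ s =
      LSeries.term (fun n => (ArithmeticFunction.sigma a n : ℂ) ^ 2) s n := by
    rw [LSeries.term_of_ne_zero n.ne_zero, ArithmeticFunction.sigma_apply]
    push_cast
    rfl
  have hsum := LSeriesSummable_sigma_sq ha hs'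
  simp_rw [hterm]
  refine ⟨hsum.comp_injective PNat.coe_injective, ?_⟩
  rw [tsum_pnat_eq_tsum_of_eq_zero (LSeries.term_zero ..), ← LSeries, LSeries_sigma_sq ha hs']
  push_cast
  congr 3 <;> ring_nf
end
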